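/- Let p, q ∈ [0, 1/2]. Then the double inequality H(p·a+(1-p)·b, p·b+(1-p)·a) < I(a,b) < H(q·a+(1-q)·b, q·b+(1-q)·a) holds for every pair of distinct positive real numbers a and b if and only if p ≤ (1 - √(1 - 2/e))/2 and q ≥ (6 - √6)/12. -/

import Mathlib

noncomputable def A (a b : ℝ) : ℝ := (a + b) / 2

noncomputable def G (a b : ℝ) : ℝ := Real.sqrt (a * b)

noncomputable def H (a b : ℝ) : ℝ := 2 * a * b / (a + b)

noncomputable def I (a b : ℝ) : ℝ :=
  (1 / Real.exp 1) * (a ^ a / b ^ b) ^ (1 / (a - b))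

noncomputable def Q (t s a b : ℝ) : ℝ :=
  G (t * a + (1 - t) * b) (t * b + (1 - t) * a) ^ s * A a b ^ (1 - s)

noncomputable def f (u s x : ℝ) : ℝ :=
  1 - (1 / (2 * x)) * Real.log ((1 + x) / (1 - x))
    - (1 / 2) * Real.log (1 - x ^ 2) + (s / 2) * Real.log (1 - u * x ^ 2)

noncomputable def h (u s x : ℝ) : ℝ :=
  -x + (1 / 2) * Real.log ((1 + x) / (1 - x)) - s * u * x ^ 3 / (1 - u * x ^ 2)

open Set Filter Topology

/-- Logarithm of the normalized identric mean `I (1 + x) (1 - x)`. -/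
noncomputable def logIdentric (x : ℝ) : ℝ :=
  ((1 + x) * Real.log (1 + x) - (1 - x) * Real.log (1 - x)) / (2 * x) - 1

/-- `2 * x` times the gap between `logIdentric x` and `Real.log (1 - w * x ^ 2)`. -/
noncomputable def logGap (w x : ℝ) : ℝ :=
  (1 + x) * Real.log (1 + x) - (1 - x) * Real.log (1 - x) - 2 * x
    - 2 * x * Real.log (1 - w * x ^ 2)

/-- The derivative of `logGap w` at `x`, as a function of `y = x ^ 2`. -/
noncomputable def logGapSlope (w y : ℝ) : ℝ :=
  Real.log (1 - y) - 2 * Real.log (1 - w * y) + 4 * (w * y) / (1 - w * y)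

/-- The derivative of `logGapSlope w` up to a positive factor. -/
def slopeNum (w y : ℝ) : ℝ := (6 * w - 1) - y * (4 * w + 2 * w ^ 2) + w ^ 2 * y ^ 2

section Monotonicity

variable {E g : ℝ → ℝ} {s t : ℝ}

lemma pos_of_hasDerivAt_pos (hs : 0 < s) (hE : ContinuousOn E (Icc 0 s))
    (hd : ∀ x ∈ Ioo 0 s, HasDerivAt E (g x) x) (hg : ∀ x ∈ Ioo 0 s, 0 < g x) (h0 : E 0 = 0) :
    0 < E s := by
  have hmono : StrictMonoOn E (Icc 0 s) := by
    refine strictMonoOn_of_deriv_pos (convex_Icc 0 s) hE fun x hx => ?_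
    rw [interior_Icc] at hx
    rw [(hd x hx).deriv]
    exact hg x hx
  simpa [h0] using hmono (left_mem_Icc.2 hs.le) (right_mem_Icc.2 hs.le) hs

/-- If the derivative changes sign at most once, from positive to negative, then a function that
vanishes at `0` and is nonnegative at `t` is positive in between. -/
lemma pos_of_deriv_sign_change (hs : 0 < s) (hst : s < t) (hE : ContinuousOn E (Icc 0 t))
    (hd : ∀ x ∈ Ioo 0 t, HasDerivAt E (g x) x)
    (hg : ∀ a c, 0 < a → a < c → c < t → 0 ≤ g c → 0 < g a) (h0 : E 0 = 0) (ht : 0 ≤ E t) :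
    0 < E s := by
  rcases le_or_gt 0 (g s) with hgs | hgs
  · exact pos_of_hasDerivAt_pos hs (hE.mono (Icc_subset_Icc_right hst.le))
      (fun x hx => hd x ⟨hx.1, hx.2.trans hst⟩) (fun x hx => hg x s hx.1 hx.2 hst hgs) h0
  · have hanti : StrictAntiOn E (Icc s t) := by
      refine strictAntiOn_of_deriv_neg (convex_Icc s t) (hE.mono (Icc_subset_Icc_left hs.le))
        fun x hx => ?_
      rw [interior_Icc] at hx
      rw [(hd x ⟨hs.trans hx.1, hx.2⟩).deriv]
      by_contra! hx0
      exact hgs.not_gt (hg s x hs hx.1 hx.2 hx0)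
    exact ht.trans_lt (hanti (left_mem_Icc.2 hst.le) (right_mem_Icc.2 hst.le) hst)

end Monotonicity

section Gap

variable {w x y : ℝ}

lemma one_sub_mul_pos (hw1 : w ≤ 1) (hy0 : 0 ≤ y) (hy1 : y < 1) : 0 < 1 - w * y := by
  nlinarith

lemma hasDerivAt_logGapSlope (hw1 : w ≤ 1) (hy0 : 0 ≤ y) (hy1 : y < 1) :
    HasDerivAt (logGapSlope w) (slopeNum w y / ((1 - y) * (1 - w * y) ^ 2)) y := by
  have h1 : (1 - y) ≠ 0 := by linarith
  have h2 : (1 - w * y) ≠ 0 := (one_sub_mul_pos hw1 hy0 hy1).ne'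
  have d1 : HasDerivAt (fun y : ℝ => 1 - y) (-1) y := (hasDerivAt_id y).const_sub 1
  have d3 : HasDerivAt (fun y : ℝ => w * y) w y := by
    simpa using (hasDerivAt_id y).const_mul w
  have d2 : HasDerivAt (fun y : ℝ => 1 - w * y) (-w) y := d3.const_sub 1
  have d := ((d1.log h1).sub ((d2.log h2).const_mul 2)).add ((d3.const_mul 4).div d2 h2)
  refine d.congr_deriv ?_
  unfold slopeNum
  generalize hv : 1 - w * y = v at h2 ⊢
  field_simp
  subst hv
  ring

lemma continuousOn_logGapSlope {t : ℝ} (hw1 : w ≤ 1) (ht : t < 1) :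
    ContinuousOn (logGapSlope w) (Icc 0 t) := fun _ hy =>
  (hasDerivAt_logGapSlope hw1 hy.1 (hy.2.trans_lt ht)).continuousAt.continuousWithinAt

lemma logGapSlope_zero : logGapSlope w 0 = 0 := by simp [logGapSlope]

lemma logGap_zero : logGap w 0 = 0 := by simp [logGap]

lemma hasDerivAt_logGap (hw1 : w ≤ 1) (hx0 : 0 ≤ x) (hx1 : x < 1) :
    HasDerivAt (logGap w) (logGapSlope w (x ^ 2)) x := by
  have h1 : (1 - x) ≠ 0 := by linarith
  have h2 : (1 + x) ≠ 0 := by linarith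
  have h3 : (1 - w * x ^ 2) ≠ 0 := (one_sub_mul_pos hw1 (sq_nonneg x) (by nlinarith)).ne'
  have d1 : HasDerivAt (fun x : ℝ => 1 - x) (-1) x := (hasDerivAt_id x).const_sub 1
  have d2 : HasDerivAt (fun x : ℝ => 1 + x) 1 x := (hasDerivAt_id x).const_add 1
  have d3 : HasDerivAt (fun x : ℝ => 1 - w * x ^ 2) (-(w * (2 * x))) x := by
    simpa using ((hasDerivAt_pow 2 x).const_mul w).const_sub 1
  have d4 : HasDerivAt (fun x : ℝ => 2 * x) 2 x := by
    simpa using (hasDerivAt_id x).const_mul (2 : ℝ)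
  have d := (((d2.mul (d2.log h2)).sub (d1.mul (d1.log h1))).sub d4).sub (d4.mul (d3.log h3))
  refine d.congr_deriv ?_
  have hl : Real.log (1 - x ^ 2) = Real.log (1 + x) + Real.log (1 - x) := by
    rw [← Real.log_mul h2 h1]
    ring_nf
  unfold logGapSlope
  rw [hl]
  field_simp
  ring

lemma continuousOn_logGap (hw0 : 0 ≤ w) (hw1 : w < 1) : ContinuousOn (logGap w) (Icc 0 1) := by
  have c (k : ℝ → ℝ) (hk : Continuous k) : Continuous fun x => k x * Real.log (k x) :=
    Real.continuous_mul_log.comp hk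
  have c1 := c (fun x => 1 + x) (by fun_prop)
  have c2 := c (fun x => 1 - x) (by fun_prop)
  have c3 : ContinuousOn (fun x : ℝ => Real.log (1 - w * x ^ 2)) (Icc 0 1) := by
    refine ContinuousOn.log (by fun_prop) fun x hx => ?_
    have : x ^ 2 ≤ 1 := by nlinarith [hx.1, hx.2]
    nlinarith
  unfold logGap
  fun_prop

lemma slopeNum_strictAnti {a c : ℝ} (hw0 : 0 < w) (hw1 : w ≤ 1) (ha : 0 ≤ a) (hac : a < c)
    (hc : c < 1) : slopeNum w c < slopeNum w a := by
  unfold slopeNum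
  have : 0 < (c - a) * (w * (4 + 2 * w - w * (a + c))) := by
    have : w * (a + c) ≤ 2 := by nlinarith
    exact mul_pos (by linarith) (mul_pos hw0 (by linarith))
  nlinarith

lemma slopeDenom_pos (hw1 : w ≤ 1) (hy0 : 0 ≤ y) (hy1 : y < 1) :
    0 < (1 - y) * (1 - w * y) ^ 2 :=
  mul_pos (by linarith) (pow_pos (one_sub_mul_pos hw1 hy0 hy1) 2)

/-- The sign of `logGapSlope w` on `(0, 1)` changes at most once, from positive to negative. -/
lemma logGapSlope_pos_of_nonneg {a c : ℝ} (hw0 : 0 < w) (hw1 : w ≤ 1) (ha : 0 < a) (hac : a < c)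
    (hc : c < 1) (h : 0 ≤ logGapSlope w c) : 0 < logGapSlope w a := by
  refine pos_of_deriv_sign_change ha hac (continuousOn_logGapSlope hw1 hc)
    (fun y hy => hasDerivAt_logGapSlope hw1 hy.1.le (hy.2.trans hc))
    (fun b d hb hbd hd hn => ?_) logGapSlope_zero h
  have hd1 := hd.trans hc
  have hn' : 0 ≤ slopeNum w d := by
    by_contra! hneg
    exact (div_neg_of_neg_of_pos hneg (slopeDenom_pos hw1 (hb.trans hbd).le hd1)).not_ge hn
  exact div_pos (hn'.trans_lt (slopeNum_strictAnti hw0 hw1 hb.le hbd hd1))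
    (slopeDenom_pos hw1 hb.le (hbd.trans hd1))

lemma logGap_pos_of_one_nonneg (hw0 : 0 < w) (hw1 : w < 1) (h : 0 ≤ logGap w 1)
    (hx0 : 0 < x) (hx1 : x < 1) : 0 < logGap w x := by
  refine pos_of_deriv_sign_change hx0 hx1 (continuousOn_logGap hw0.le hw1)
    (fun y hy => hasDerivAt_logGap hw1.le hy.1.le hy.2)
    (fun b d hb hbd hd hn => ?_) logGap_zero h
  exact logGapSlope_pos_of_nonneg hw0 hw1.le (pow_pos hb 2) (by nlinarith) (by nlinarith) hn

lemma continuousOn_logGap_of_lt {t : ℝ} (hw1 : w ≤ 1) (ht : t < 1) :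
    ContinuousOn (logGap w) (Icc 0 t) := fun _ hy =>
  (hasDerivAt_logGap hw1 hy.1 (hy.2.trans_lt ht)).continuousAt.continuousWithinAt

lemma logGap_one_sixth_neg (hx0 : 0 < x) (hx1 : x < 1) : logGap (1 / 6) x < 0 := by
  have hw : (1 / 6 : ℝ) ≤ 1 := by norm_num
  have slope_neg {y : ℝ} (hy0 : 0 < y) (hy1 : y < 1) : logGapSlope (1 / 6) y < 0 := by
    refine neg_pos.1 (pos_of_hasDerivAt_pos (E := fun y => -logGapSlope (1 / 6) y) hy0
      (continuousOn_logGapSlope hw hy1).neg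
      (fun z hz => (hasDerivAt_logGapSlope hw hz.1.le (hz.2.trans hy1)).neg)
      (fun z hz => ?_) (by simp [logGapSlope_zero]))
    refine neg_pos.2 (div_neg_of_neg_of_pos ?_ (slopeDenom_pos hw hz.1.le (hz.2.trans hy1)))
    unfold slopeNum
    nlinarith [hz.1, hz.2]
  refine neg_pos.1 (pos_of_hasDerivAt_pos (E := fun y => -logGap (1 / 6) y) hx0
    (continuousOn_logGap_of_lt hw hx1).neg
    (fun z hz => (hasDerivAt_logGap hw hz.1.le (hz.2.trans hx1)).neg)
    (fun z hz => ?_) (by simp [logGap_zero]))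
  exact neg_pos.2 (slope_neg (pow_pos hz.1 2) (by nlinarith [hz.1, hz.2]))

lemma exists_logGap_pos (hw : 1 / 6 < w) (hw1 : w ≤ 1) :
    ∃ x, 0 < x ∧ x < 1 ∧ 0 < logGap w x := by
  have hw0 : 0 < w := by linarith
  set t : ℝ := (6 * w - 1) / 6 with ht
  have ht0 : 0 < t := by linarith
  have ht1 : t < 1 := by linarith
  have hnum : 0 ≤ slopeNum w t := by
    unfold slopeNum
    have : 6 * w - 1 = 6 * t := by linarith
    rw [this]
    have : 0 ≤ t * (6 - 4 * w - 2 * w ^ 2) := mul_nonneg ht0.le (by nlinarith)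
    nlinarith [sq_nonneg (w * t)]
  refine ⟨t, ht0, ht1, pos_of_hasDerivAt_pos ht0 (continuousOn_logGap_of_lt hw1 ht1)
    (fun z hz => hasDerivAt_logGap hw1 hz.1.le (hz.2.trans ht1)) (fun z hz => ?_) logGap_zero⟩
  have hzt : z ^ 2 < t := by nlinarith [hz.1, hz.2]
  refine pos_of_hasDerivAt_pos (pow_pos hz.1 2) (continuousOn_logGapSlope hw1 (hzt.trans ht1))
    (fun y hy => hasDerivAt_logGapSlope hw1 hy.1.le (hy.2.trans (hzt.trans ht1)))
    (fun y hy => ?_) logGapSlope_zero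
  have hyt := hy.2.trans hzt
  exact div_pos (hnum.trans_lt (slopeNum_strictAnti hw0 hw1 hy.1.le hyt ht1))
    (slopeDenom_pos hw1 hy.1.le (hyt.trans ht1))

lemma logGap_eq (hx : x ≠ 0) :
    logGap w x = 2 * x * (logIdentric x - Real.log (1 - w * x ^ 2)) := by
  unfold logGap logIdentric
  field_simp

lemma lt_exp_logIdentric_iff (hw1 : w ≤ 1) (hx0 : 0 < x) (hx1 : x < 1) :
    1 - w * x ^ 2 < Real.exp (logIdentric x) ↔ 0 < logGap w x := by
  rw [← Real.log_lt_iff_lt_exp (one_sub_mul_pos hw1 (sq_nonneg x) (by nlinarith)),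
    logGap_eq hx0.ne', mul_pos_iff_of_pos_left (by linarith), sub_pos]

lemma exp_logIdentric_lt_iff (hw1 : w ≤ 1) (hx0 : 0 < x) (hx1 : x < 1) :
    Real.exp (logIdentric x) < 1 - w * x ^ 2 ↔ logGap w x < 0 := by
  rw [← Real.lt_log_iff_exp_lt (one_sub_mul_pos hw1 (sq_nonneg x) (by nlinarith)),
    logGap_eq hx0.ne', ← neg_pos, ← mul_neg, mul_pos_iff_of_pos_left (by linarith), neg_sub,
    sub_pos]

end Gap

lemma exp_logIdentric_one : Real.exp (logIdentric 1) = 2 / Real.exp 1 := by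
  have : logIdentric 1 = Real.log 2 - 1 := by
    unfold logIdentric
    norm_num
  rw [this, Real.exp_sub, Real.exp_log two_pos]

lemma continuousAt_logIdentric_one : ContinuousAt logIdentric 1 := by
  have c (k : ℝ → ℝ) (hk : Continuous k) : Continuous fun x => k x * Real.log (k x) :=
    Real.continuous_mul_log.comp hk
  have c1 := c (fun x => 1 + x) (by fun_prop)
  have c2 := c (fun x => 1 - x) (by fun_prop)
  unfold logIdentric
  exact ((c1.sub c2).continuousAt.div (by fun_prop) (by norm_num)).sub continuousAt_const

lemma two_div_exp_one_mem : 0 < 2 / Real.exp 1 ∧ 2 / Real.exp 1 < 5 / 6 := by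
  have := Real.exp_one_gt_d9
  refine ⟨by positivity, ?_⟩
  rw [div_lt_iff₀ (by positivity)]
  linarith

/-- The sharp constant for the lower bound. -/
lemma forall_lt_exp_logIdentric_iff {w : ℝ} :
    (∀ x, 0 < x → x < 1 → 1 - w * x ^ 2 < Real.exp (logIdentric x)) ↔
      1 - 2 / Real.exp 1 ≤ w := by
  obtain ⟨he0, he1⟩ := two_div_exp_one_mem
  constructor
  · intro hlt
    have hl : Tendsto (fun x : ℝ => 1 - w * x ^ 2) (𝓝[<] 1) (𝓝 (1 - w * 1 ^ 2)) :=
      ((by fun_prop : Continuous fun x : ℝ => 1 - w * x ^ 2).tendsto 1).mono_left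
        nhdsWithin_le_nhds
    have hr : Tendsto (fun x : ℝ => Real.exp (logIdentric x)) (𝓝[<] 1)
        (𝓝 (Real.exp (logIdentric 1))) :=
      (continuousAt_logIdentric_one.rexp).tendsto.mono_left nhdsWithin_le_nhds
    have := le_of_tendsto_of_tendsto hl hr (by
      filter_upwards [Ioo_mem_nhdsLT (zero_lt_one' ℝ)] with x hx using (hlt x hx.1 hx.2).le)
    rw [exp_logIdentric_one] at this
    linarith
  · intro hle x hx0 hx1
    have hgap : logGap (1 - 2 / Real.exp 1) 1 = 0 := by
      rw [logGap_eq one_ne_zero, one_pow, mul_one, mul_one, sub_sub_cancel, ← exp_logIdentric_one,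
        Real.log_exp, sub_self, mul_zero]
    have := (lt_exp_logIdentric_iff (by linarith) hx0 hx1).2
      (logGap_pos_of_one_nonneg (by linarith) (by linarith) hgap.ge hx0 hx1)
    nlinarith [sq_nonneg x]

/-- The sharp constant for the upper bound. -/
lemma forall_exp_logIdentric_lt_iff {w : ℝ} (hw1 : w ≤ 1) :
    (∀ x, 0 < x → x < 1 → Real.exp (logIdentric x) < 1 - w * x ^ 2) ↔ w ≤ 1 / 6 := by
  constructor
  · intro hlt
    by_contra! hw
    obtain ⟨x, hx0, hx1, hx⟩ := exists_logGap_pos hw hw1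
    exact hx.not_gt ((exp_logIdentric_lt_iff hw1 hx0 hx1).1 (hlt x hx0 hx1))
  · intro hle x hx0 hx1
    have := (exp_logIdentric_lt_iff (by norm_num) hx0 hx1).2 (logGap_one_sixth_neg hx0 hx1)
    nlinarith [sq_nonneg x]

lemma I_eq_mul_exp_logIdentric {c x : ℝ} (hc : 0 < c) (hx0 : 0 < x) (hx1 : x < 1) :
    I (c * (1 + x)) (c * (1 - x)) = c * Real.exp (logIdentric x) := by
  have h1 : 0 < 1 + x := by linarith
  have h2 : 0 < 1 - x := by linarith
  unfold I logIdentric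
  rw [Real.rpow_def_of_pos (mul_pos hc h1), Real.rpow_def_of_pos (mul_pos hc h2),
    ← Real.exp_sub, ← Real.exp_mul, one_div, ← Real.exp_neg, ← Real.exp_add,
    Real.log_mul hc.ne' h1.ne', Real.log_mul hc.ne' h2.ne']
  conv_rhs => rw [← Real.exp_log hc, ← Real.exp_add]
  congr 1
  have : c * (1 + x) - c * (1 - x) = 2 * c * x := by ring
  rw [this]
  field_simp
  ring

lemma H_convex_combination {c x : ℝ} (hc : 0 < c) (r : ℝ) :
    H (r * (c * (1 + x)) + (1 - r) * (c * (1 - x))) (r * (c * (1 - x)) + (1 - r) * (c * (1 + x)))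
      = c * (1 - (1 - 2 * r) ^ 2 * x ^ 2) := by
  unfold H
  have : r * (c * (1 + x)) + (1 - r) * (c * (1 - x)) +
      (r * (c * (1 - x)) + (1 - r) * (c * (1 + x))) = 2 * c := by ring
  rw [this]
  field_simp
  ring

lemma H_comm (a b : ℝ) : H a b = H b a := by
  unfold H
  ring

lemma I_comm {a b : ℝ} (ha : 0 < a) (hb : 0 < b) : I a b = I b a := by
  have hq : b ^ b / a ^ a = (a ^ a / b ^ b)⁻¹ := (inv_div _ _).symm
  have hpos : 0 ≤ a ^ a / b ^ b := by positivity
  have hexp : 1 / (b - a) = -(1 / (a - b)) := by rw [← neg_sub, one_div_neg_eq_neg_one_div]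
  unfold I
  rw [hq, hexp, Real.inv_rpow hpos, Real.rpow_neg hpos, inv_inv]

lemma forall_H_lt_I_lt_H_iff (p q : ℝ) :
    (∀ a b : ℝ, 0 < a → 0 < b → a ≠ b →
        H (p*a + (1-p)*b) (p*b + (1-p)*a) < I a b ∧
          I a b < H (q*a + (1-q)*b) (q*b + (1-q)*a)) ↔
      ∀ x, 0 < x → x < 1 → 1 - (1 - 2 * p) ^ 2 * x ^ 2 < Real.exp (logIdentric x) ∧
        Real.exp (logIdentric x) < 1 - (1 - 2 * q) ^ 2 * x ^ 2 := by
  have key {c x : ℝ} (hc : 0 < c) (hx0 : 0 < x) (hx1 : x < 1) :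
      (H (p * (c * (1 + x)) + (1-p) * (c * (1 - x))) (p * (c * (1 - x)) + (1-p) * (c * (1 + x)))
          < I (c * (1 + x)) (c * (1 - x)) ∧
        I (c * (1 + x)) (c * (1 - x)) <
          H (q * (c * (1 + x)) + (1-q) * (c * (1 - x)))
            (q * (c * (1 - x)) + (1-q) * (c * (1 + x)))) ↔
      1 - (1 - 2 * p) ^ 2 * x ^ 2 < Real.exp (logIdentric x) ∧
        Real.exp (logIdentric x) < 1 - (1 - 2 * q) ^ 2 * x ^ 2 := by
    rw [H_convex_combination hc, H_convex_combination hc, I_eq_mul_exp_logIdentric hc hx0 hx1,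
      mul_lt_mul_iff_right₀ hc, mul_lt_mul_iff_right₀ hc]
  constructor
  · intro hab x hx0 hx1
    exact (key one_pos hx0 hx1).1
      (hab _ _ (by linarith) (by linarith) fun h => by linarith)
  · intro hx a b ha hb hne
    wlog hba : b < a generalizing a b
    · have := this b a hb ha hne.symm (lt_of_le_of_ne (not_lt.1 hba) hne)
      rwa [I_comm hb ha, H_comm (p * b + _), H_comm (q * b + _)] at this
    have hs : 0 < a + b := by linarith
    have hx0 : 0 < (a - b) / (a + b) := div_pos (by linarith) hs
    have hx1 : (a - b) / (a + b) < 1 := by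
      rw [div_lt_one hs]
      linarith
    have hk := (key (half_pos hs) hx0 hx1).2 (hx _ hx0 hx1)
    have ea : (a + b) / 2 * (1 + (a - b) / (a + b)) = a := by
      field_simp
      ring
    have eb : (a + b) / 2 * (1 - (a - b) / (a + b)) = b := by
      field_simp
      ring
    rwa [ea, eb] at hk

theorem stmt_9 (p q : ℝ) (hp : p ∈ Set.Icc (0:ℝ) (1/2)) (hq : q ∈ Set.Icc (0:ℝ) (1/2)) :
    (∀ a b : ℝ, 0 < a → 0 < b → a ≠ b →
        H (p*a + (1-p)*b) (p*b + (1-p)*a) < I a b ∧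
          I a b < H (q*a + (1-q)*b) (q*b + (1-q)*a)) ↔
      p ≤ (1 - Real.sqrt (1 - 2 / Real.exp 1)) / 2 ∧ (6 - Real.sqrt 6) / 12 ≤ q := by
  obtain ⟨hp0, hp2⟩ := hp
  obtain ⟨hq0, hq2⟩ := hq
  rw [forall_H_lt_I_lt_H_iff]
  have hsplit {P R : ℝ → Prop} : (∀ x, 0 < x → x < 1 → P x ∧ R x) ↔
      (∀ x, 0 < x → x < 1 → P x) ∧ ∀ x, 0 < x → x < 1 → R x := by
    grind
  rw [hsplit, forall_lt_exp_logIdentric_iff,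
    forall_exp_logIdentric_lt_iff (by nlinarith)]
  refine and_congr ?_ ?_
  · rw [← Real.sqrt_le_left (by linarith)]
    constructor <;> intro <;> linarith
  · have h6 : Real.sqrt 6 ^ 2 = 6 := Real.sq_sqrt (by norm_num)
    have hpos : 0 < Real.sqrt 6 := Real.sqrt_pos.2 (by norm_num)
    have : (1 / 6 : ℝ) = (Real.sqrt 6 / 6) ^ 2 := by rw [div_pow, h6]; norm_num
    rw [this, sq_le_sq₀ (by linarith) (by positivity)]
    constructor <;> intro <;> linarith
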